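/- Define T : ℤ → ℕ by the initial values T(−3)=1, T(−2)=0, T(−1)=0, T(0)=2, T(1)=1, and for k ≥ 2 by T(k) = mex{ P(i−2) XOR T(k−1−i) : 1 ≤ i ≤ k+2 }, where P is the Dawson's-chess Grundy sequence of paths. Then T (the Grundy sequence of Node-Kayles on the star T_{2} grafted to a path of length k) is eventually periodic with period 34: T(k) = T(k−34) for all k ≥ 345. -/

import Mathlib

/-- The minimum excluded value of a finite set of naturals. -/
noncomputable def mex (s : Finset ℕ) : ℕ := sInf {n : ℕ | n ∉ s}

/-- Nibble-encoded values of the shifted path sequence `a ↦ P (a - 1)`. -/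
def pTab : ℕ := 334459143127867603599404240223807164892842025680332433936076868554005742282202780990426829442355409588480

/-- Nibble-encoded values of the shifted sequence `b ↦ T (b - 3)`. -/
def tTab : ℕ := 100999079666170372871683421469939655750653645246272159795600401084362273980363009892102943325799058302064613357774953331968141137519309926356134130316029055837680776975639873185108321442296927071868996724489804569415398984639336123442558048364914975729145398932278672974870276234626112142180512685464440780754737576328428563166226745331343786954719599155626026085701539638713371089322199019062697437670281078704109068289

/-- Look up an index in a table with preperiod `a` and period 34. -/
def look (tab a n : ℕ) : ℕ :=
  Nat.mod (Nat.shiftRight tab (Nat.mul 4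
    (Bool.rec (Nat.add a (Nat.mod (Nat.sub n a) 34)) n (Nat.ble (Nat.succ n) a)))) 16

def pF (n : ℕ) : ℕ := look pTab 53 n

def tF (n : ℕ) : ℕ := look tTab 314 n

theorem look_periodic (tab a n : ℕ) (h : a ≤ n) : look tab a (n + 34) = look tab a n := by
  have h1 : Nat.ble (Nat.succ (n + 34)) a = false := by
    rw [Bool.eq_false_iff, ne_eq, Nat.ble_eq]; omega
  have h2 : Nat.ble (Nat.succ n) a = false := by
    rw [Bool.eq_false_iff, ne_eq, Nat.ble_eq]; omega
  have h3 : Nat.mod (Nat.sub (n + 34) a) 34 = Nat.mod (Nat.sub n a) 34 := by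
    change (n + 34 - a) % 34 = (n - a) % 34
    omega
  simp only [look, h1, h2, h3]

/-- Bit set of the values `p j ^^^ t (n - 1 - j)` for `j < c`. -/
def bits (p t : ℕ → ℕ) (n : ℕ) : ℕ → ℕ
  | 0 => 0
  | c + 1 => Nat.lor (Nat.shiftLeft 1 (Nat.xor (p c) (t (Nat.sub (Nat.sub n 1) c))))
      (bits p t n c)

theorem testBit_bits (p t : ℕ → ℕ) (n c m : ℕ) :
    (bits p t n c).testBit m = true ↔ ∃ j < c, p j ^^^ t (n - 1 - j) = m := by
  induction c with
  | zero => simp [bits]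
  | succ c ih =>
    have hb : bits p t n (c + 1) =
        (1 <<< (p c ^^^ t (n - 1 - c))) ||| bits p t n c := rfl
    rw [hb, Nat.testBit_or, Bool.or_eq_true, ih, Nat.one_shiftLeft, Nat.testBit_two_pow]
    simp only [decide_eq_true_eq]
    constructor
    · rintro (h | ⟨j, hj, h⟩)
      · exact ⟨c, by omega, h⟩
      · exact ⟨j, by omega, h⟩
    · rintro ⟨j, hj, h⟩
      rcases Nat.lt_succ_iff_lt_or_eq.mp hj with h' | h'
      · exact Or.inr ⟨j, h', h⟩
      · subst h'; exact Or.inl h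

/-- `m` is the minimum excluded value of `p j ^^^ t (n - 1 - j)`, `j < n`. -/
def Good (p t : ℕ → ℕ) (n m : ℕ) : Prop :=
  (¬ ∃ j < n, p j ^^^ t (n - 1 - j) = m) ∧
    ∀ x < m, ∃ j < n, p j ^^^ t (n - 1 - j) = x

def goodB (p t : ℕ → ℕ) (n : ℕ) : Bool :=
  Nat.beq (bits p t n n % (2 ^ (t (n + 1) + 1))) (2 ^ t (n + 1) - 1)

theorem good_of_goodB (p t : ℕ → ℕ) (n : ℕ) (h : goodB p t n = true) :
    Good p t n (t (n + 1)) := by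
  have h' := Nat.eq_of_beq_eq_true h
  have key : ∀ x ≤ t (n + 1),
      ((bits p t n n).testBit x = true ↔ x < t (n + 1)) := by
    intro x hx
    have := congrArg (fun z => Nat.testBit z x) h'
    simp only [Nat.testBit_mod_two_pow, Nat.testBit_two_pow_sub_one] at this
    have hlt : x < t (n + 1) + 1 := by omega
    simp only [hlt, decide_true, Bool.true_and] at this
    rw [this, decide_eq_true_eq]
  constructor
  · rw [← testBit_bits, key _ le_rfl]; omega
  · intro x hx
    rw [← testBit_bits, key _ hx.le]; exact hx

/-- Check `goodB` for `n` from `s` to `s + c - 1`. -/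
def allB (p t : ℕ → ℕ) (s : ℕ) : ℕ → Bool
  | 0 => true
  | c + 1 => goodB p t (s + c) && allB p t s c

theorem allB_spec (p t : ℕ → ℕ) (s c : ℕ) (h : allB p t s c = true) :
    ∀ j < c, goodB p t (s + j) = true := by
  induction c with
  | zero => intro j hj; omega
  | succ c ih =>
    rw [allB, Bool.and_eq_true] at h
    intro j hj
    rcases Nat.lt_succ_iff_lt_or_eq.mp hj with h' | h'
    · exact ih h.2 j h'
    · subst h'; exact h.1

set_option maxRecDepth 100000 in
theorem p_check : allB pF pF 0 175 = true := by decide +kernel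

set_option maxRecDepth 100000 in
theorem t_check : allB pF tF 4 432 = true := by decide +kernel

theorem set_shift (p t : ℕ → ℕ) (a b : ℕ) (hp : ∀ n, a ≤ n → p (n + 34) = p n)
    (ht : ∀ n, b ≤ n → t (n + 34) = t n) (n : ℕ) (hn : a + b + 35 ≤ n) (x : ℕ) :
    (∃ j < n + 34, p j ^^^ t (n + 34 - 1 - j) = x) ↔ ∃ j < n, p j ^^^ t (n - 1 - j) = x := by
  constructor
  · rintro ⟨j, hj, h⟩
    by_cases hc : a + 34 ≤ j
    · refine ⟨j - 34, by omega, ?_⟩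
      have h1 := hp (j - 34) (by omega)
      rw [show j - 34 + 34 = j by omega] at h1
      rw [← h1, show n - 1 - (j - 34) = n + 34 - 1 - j by omega, h]
    · refine ⟨j, by omega, ?_⟩
      rw [← ht _ (by omega), show n - 1 - j + 34 = n + 34 - 1 - j by omega, h]
  · rintro ⟨j, hj, h⟩
    by_cases hc : a ≤ j
    · refine ⟨j + 34, by omega, ?_⟩
      rw [hp j hc, show n + 34 - 1 - (j + 34) = n - 1 - j by omega, h]
    · refine ⟨j, by omega, ?_⟩
      rw [show n + 34 - 1 - j = n - 1 - j + 34 by omega, ht _ (by omega), h]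

theorem good_all (p t : ℕ → ℕ) (a b s : ℕ) (hp : ∀ n, a ≤ n → p (n + 34) = p n)
    (ht : ∀ n, b ≤ n → t (n + 34) = t n) (hs : s ≤ a + b)
    (hc : ∀ n, s ≤ n → n < a + b + 69 → Good p t n (t (n + 1))) :
    ∀ n, s ≤ n → Good p t n (t (n + 1)) := by
  intro n
  induction n using Nat.strong_induction_on with
  | _ n ih =>
    intro hsn
    by_cases h : n < a + b + 69
    · exact hc n hsn h
    · obtain ⟨m, rfl⟩ : ∃ m, n = m + 34 := ⟨n - 34, by omega⟩
      have := ih m (by omega) (by omega)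
      rw [show m + 34 + 1 = m + 1 + 34 by omega, ht (m + 1) (by omega)]
      unfold Good at this ⊢
      simp only [set_shift p t a b hp ht m (by omega)]
      exact this

theorem pF_good (n : ℕ) : Good pF pF n (pF (n + 1)) := by
  refine good_all pF pF 53 53 0 (fun n hn => look_periodic _ _ n hn)
    (fun n hn => look_periodic _ _ n hn) (by omega) ?_ n (by omega)
  intro m _ hm
  have := allB_spec _ _ _ _ p_check m (by omega)
  rw [Nat.zero_add] at this
  exact good_of_goodB _ _ _ this

theorem tF_good (n : ℕ) (hn : 4 ≤ n) : Good pF tF n (tF (n + 1)) := by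
  refine good_all pF tF 53 314 4 (fun n hn => look_periodic _ _ n hn)
    (fun n hn => look_periodic _ _ n hn) (by omega) ?_ n hn
  intro m hm1 hm
  have := allB_spec _ _ _ _ t_check (m - 4) (by omega)
  rw [show 4 + (m - 4) = m by omega] at this
  exact good_of_goodB _ _ _ this

theorem mex_eq (s : Finset ℕ) (m : ℕ) (h1 : m ∉ s) (h2 : ∀ x < m, x ∈ s) : mex s = m := by
  unfold mex
  apply le_antisymm
  · exact Nat.sInf_le h1
  · refine le_csInf ⟨m, h1⟩ ?_
    intro b hb
    by_contra hlt
    exact hb (h2 b (by omega))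

/-- If `P`, `T` agree with `p`, `t` below, the `mex` of the game options is `m`. -/
theorem mex_of_good (P T : ℤ → ℕ) (p t : ℕ → ℕ) (n m : ℕ) (c : ℤ) (d : ℤ)
    (hd : d = n - 1 - c)
    (hP : ∀ j < n, P ((j : ℤ) - 1) = p j) (hT : ∀ j < n, T ((j : ℤ) - c) = t j)
    (hg : Good p t n m) :
    mex ((Finset.Icc 1 (n : ℤ)).image fun i => P (i - 2) ^^^ T (d + 1 - i)) = m := by
  have mem : ∀ x, x ∈ ((Finset.Icc 1 (n : ℤ)).image fun i => P (i - 2) ^^^ T (d + 1 - i)) ↔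
      ∃ j < n, p j ^^^ t (n - 1 - j) = x := by
    intro x
    rw [Finset.mem_image]
    constructor
    · rintro ⟨i, hi, h⟩
      rw [Finset.mem_Icc] at hi
      obtain ⟨j, hj⟩ : ∃ j : ℕ, i = j + 1 := ⟨(i - 1).toNat, by omega⟩
      refine ⟨j, by omega, ?_⟩
      rw [← h, ← hP j (by omega), ← hT (n - 1 - j) (by omega)]
      congr 2 <;> omega
    · rintro ⟨j, hj, h⟩
      refine ⟨(j : ℤ) + 1, by rw [Finset.mem_Icc]; omega, ?_⟩
      rw [← h, ← hP j (by omega), ← hT (n - 1 - j) (by omega)]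
      congr 2 <;> omega
  apply mex_eq
  · rw [mem]; exact hg.1
  · intro x hx; rw [mem]; exact hg.2 x hx

/-- Let `P : ℤ → ℕ` be the Dawson's-chess Grundy sequence of paths and let
`T : ℤ → ℕ` have the initial values `T(-3)=1, T(-2)=0, T(-1)=0, T(0)=2, T(1)=1`
and satisfy `T k = mex{ P(i-2) ^^^ T(k-1-i) : 1 ≤ i ≤ k+2 }` for `k ≥ 2` (the
Grundy sequence of Node-Kayles on the star with two leaves grafted to a path of
`k` vertices).  Then `T` is eventually periodic with period 34:
`T k = T (k - 34)` for all `k ≥ 345`. -/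
theorem starTail_eventually_periodic (P T : ℤ → ℕ)
    (hP0 : ∀ n : ℤ, n ≤ 0 → P n = 0)
    (hPrec : ∀ n : ℤ, 1 ≤ n →
      P n = mex ((Finset.Icc 1 n).image fun i => P (i - 2) ^^^ P (n - 1 - i)))
    (hT3 : T (-3) = 1) (hT2 : T (-2) = 0) (hT1 : T (-1) = 0)
    (hT0 : T 0 = 2) (hTone : T 1 = 1)
    (hTrec : ∀ k : ℤ, 2 ≤ k →
      T k = mex ((Finset.Icc 1 (k + 2)).image fun i => P (i - 2) ^^^ T (k - 1 - i))) :
    ∀ k : ℤ, 345 ≤ k → T k = T (k - 34) := by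
  have hPp : ∀ n : ℕ, P ((n : ℤ) - 1) = pF n := by
    intro n
    induction n using Nat.strong_induction_on with
    | _ n ih =>
      by_cases h : n ≤ 1
      · rw [hP0 _ (by omega)]
        interval_cases n <;> decide +kernel
      · obtain ⟨m, rfl⟩ : ∃ m, n = m + 1 := ⟨n - 1, by omega⟩
        rw [show ((m + 1 : ℕ) : ℤ) - 1 = (m : ℤ) by push_cast; ring, hPrec _ (by omega)]
        have := mex_of_good P P pF pF m (pF (m + 1)) 1 ((m : ℤ) - 2) (by ring)
          (fun j hj => ih j (by omega)) (fun j hj => ih j (by omega)) (pF_good m)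
        rw [← this]
        congr 2
        funext i
        congr 2
        ring
  have hTt : ∀ n : ℕ, T ((n : ℤ) - 3) = tF n := by
    intro n
    induction n using Nat.strong_induction_on with
    | _ n ih =>
      by_cases h : n ≤ 4
      · interval_cases n
        · exact hT3.trans (by decide +kernel)
        · exact hT2.trans (by decide +kernel)
        · exact hT1.trans (by decide +kernel)
        · exact hT0.trans (by decide +kernel)
        · exact hTone.trans (by decide +kernel)
      · obtain ⟨m, rfl⟩ : ∃ m, n = m + 1 := ⟨n - 1, by omega⟩
        rw [show ((m + 1 : ℕ) : ℤ) - 3 = (m : ℤ) - 2 by push_cast; ring, hTrec _ (by omega)]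
        have := mex_of_good P T pF tF m (tF (m + 1)) 3 ((m : ℤ) - 4) (by ring)
          (fun j hj => hPp j) (fun j hj => ih j (by omega)) (tF_good m (by omega))
        rw [← this, show (m : ℤ) - 2 + 2 = m by ring]
        congr 2
        funext i
        congr 2
        ring
  intro k hk
  obtain ⟨n, rfl⟩ : ∃ n : ℕ, k = (n : ℤ) + 34 - 3 := ⟨(k - 31).toNat, by omega⟩
  rw [show (n : ℤ) + 34 - 3 - 34 = (n : ℤ) - 3 by ring, hTt n,
    show (n : ℤ) + 34 - 3 = ((n + 34 : ℕ) : ℤ) - 3 by push_cast; ring, hTt]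
  exact look_periodic _ _ n (by omega)
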